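/- Let 4 ≤ k ≤ n−2 be integers with k even, set p̄₁ = 1 − 1/(n−k+1), and let ρ̄ be the infimum of all p̄₂ ≤ p̄₁ such that M(n,k,p) = B(n, k, 1−p) + (C(n, k+1)/C(n−k+1, 2)) · (1−p)^{k−1} · B(n−k+1, 1, 1−p) holds for all p ∈ [p̄₂, p̄₁]. Then the cubic polynomial g(p) = 1 − C(n−k+3,1)·(1−p) + (5/6)·C(n−k+3,2)·(1−p)² − (1/2)·C(n−k+3,3)·(1−p)³ has a unique zero in the interval [1 − 2/(n−k+1), 1 − 1/(n−k+1)], and ρ̄ equals this zero. -/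

import Mathlib

open scoped BigOperators

noncomputable section

/-- The probability, under the mass function `f` on `{0,1}^n`, of the event that
all coordinates in `S` equal `1` (i.e. `true`). -/
def prAll {n : ℕ} (f : (Fin n → Bool) → ℝ) (S : Finset (Fin n)) : ℝ :=
  ∑ x ∈ Finset.univ.filter (fun x : Fin n → Bool => ∀ i ∈ S, x i = true), f x

/-- `f` is the mass function of a probability measure on `{0,1}^n` making the
coordinate random variables `k`-wise independent Bernoulli(`p`) bits:
`P(X_{i₁} = ⋯ = X_{i_s} = 1) = p ^ s` for all `1 ≤ s ≤ k`. -/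
def memA (n k : ℕ) (p : ℝ) (f : (Fin n → Bool) → ℝ) : Prop :=
  (∀ x, 0 ≤ f x) ∧ (∑ x, f x) = 1 ∧
    ∀ S : Finset (Fin n), 1 ≤ S.card → S.card ≤ k → prAll f S = p ^ S.card

/-- `M n k p`: the maximum of `P(X₁ = ⋯ = Xₙ = 1)` over `A(n,k,p)`. -/
def M (n k : ℕ) (p : ℝ) : ℝ :=
  sSup {y : ℝ | ∃ f, memA n k p f ∧ prAll f Finset.univ = y}

/-- Bonferroni polynomial `B(m,l,x) = Σ_{i=0}^{l} (−1)^i C(m,i) x^i`;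
by convention it is `0` for negative `l`. -/
def bonf (m : ℕ) (l : ℤ) (x : ℝ) : ℝ :=
  if l < 0 then 0
  else ∑ i ∈ Finset.range (l.toNat + 1), (-1 : ℝ) ^ i * (m.choose i) * x ^ i

/-- The cubic polynomial
`g(p) = 1 - C(n-k+3,1)(1-p) + (5/6) C(n-k+3,2)(1-p)² - (1/2) C(n-k+3,3)(1-p)³`. -/
def gcubic (n k : ℕ) (p : ℝ) : ℝ :=
  1 - ((n - k + 3).choose 1 : ℝ) * (1 - p) + 5 / 6 * ((n - k + 3).choose 2 : ℝ) * (1 - p) ^ 2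
    - 1 / 2 * ((n - k + 3).choose 3 : ℝ) * (1 - p) ^ 3

/-- The expectation of `F` under the binomial distribution with parameters `N` and `x`. -/
def binE (N : ℕ) (x : ℝ) (F : ℕ → ℝ) : ℝ :=
  ∑ u ∈ Finset.range (N + 1), (N.choose u : ℝ) * x ^ u * (1 - x) ^ (N - u) * F u

/-- The function on `ℕ` of degree `r + 2` which is `1` at `0` and vanishes at
`1, …, r, r + 2, r + 3`. -/
def nodeFun (r v : ℕ) : ℝ :=
  ∑ s ∈ Finset.range (r + 3), (-1 : ℝ) ^ s * (v.choose s : ℝ) +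
    (-1) ^ r * (2 / (((r : ℝ) + 2) * (r + 3))) *
      ((v.choose (r + 1) : ℝ) - (r + 2) * (v.choose (r + 2) : ℝ))

lemma alternating_choose_succ (v l : ℕ) :
    ∑ s ∈ Finset.range (l + 1), (-1 : ℝ) ^ s * ((v + 1).choose s : ℝ) =
      (-1) ^ l * (v.choose l : ℝ) := by
  induction l with
  | zero => simp
  | succ l ih =>
    rw [Finset.sum_range_succ, ih, Nat.choose_succ_succ']
    push_cast
    ring

lemma nodeFun_zero (r : ℕ) : nodeFun r 0 = 1 := by
  simp [nodeFun, Finset.sum_range_succ']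

lemma nodeFun_eq_zero {r v : ℕ} (h1 : 1 ≤ v) (h2 : v ≤ r) : nodeFun r v = 0 := by
  obtain ⟨v, rfl⟩ : ∃ w, v = w + 1 := ⟨v - 1, by omega⟩
  rw [nodeFun, alternating_choose_succ, Nat.choose_eq_zero_of_lt (by omega : v < r + 2),
    Nat.choose_eq_zero_of_lt (by omega : v + 1 < r + 1),
    Nat.choose_eq_zero_of_lt (by omega : v + 1 < r + 2)]
  simp

lemma nodeFun_add (r w : ℕ) :
    nodeFun r (r + 1 + w) =
      (-1) ^ r * ((r + w).choose r * (((w : ℝ) - 1) * (w - 2)) / (((r : ℝ) + 2) * (r + 3))) := by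
  have e : r + 1 + w = (r + w) + 1 := by omega
  rw [nodeFun, e, alternating_choose_succ]
  have h1 : ((r + w).choose (r + 1) : ℝ) * (r + 1) = (r + w).choose r * w := by
    have := Nat.choose_succ_right_eq (r + w) r
    rw [Nat.add_sub_cancel_left] at this
    exact_mod_cast this
  have h2 : ((r + w).choose (r + 2) : ℝ) * (r + 2) = (r + w).choose (r + 1) * (w - 1) := by
    rcases Nat.eq_zero_or_pos w with rfl | hw
    · simp [Nat.choose_eq_zero_of_lt]
    · have := Nat.choose_succ_right_eq (r + w) (r + 1)
      rw [show r + w - (r + 1) = w - 1 by omega] at this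
      have h : (((r + w).choose (r + 2) * (r + 2) : ℕ) : ℝ) =
        ((r + w).choose (r + 1) * (w - 1) : ℕ) := by exact_mod_cast this
      push_cast [Nat.cast_sub hw] at h
      exact h
  rw [Nat.choose_succ_succ' (r + w) r, Nat.choose_succ_succ' (r + w) (r + 1)]
  push_cast
  set c0 : ℝ := (((r + w).choose r : ℕ) : ℝ)
  set c1 : ℝ := (((r + w).choose (r + 1) : ℕ) : ℝ)
  set c2 : ℝ := (((r + w).choose (r + 2) : ℕ) : ℝ)
  have hr : (0 : ℝ) ≤ r := r.cast_nonneg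
  have e1 : c1 = c0 * w / (r + 1) := by field_simp; linarith
  have e2 : c2 = c1 * (w - 1) / (r + 2) := by field_simp; linarith
  rw [e2, e1, pow_add]
  field_simp
  ring

lemma binE_add (N : ℕ) (x : ℝ) (F G : ℕ → ℝ) :
    binE N x (F + G) = binE N x F + binE N x G := by
  simp [binE, mul_add, Finset.sum_add_distrib]

lemma binE_smul (N : ℕ) (x c : ℝ) (F : ℕ → ℝ) : binE N x (c • F) = c * binE N x F := by
  rw [binE, binE, Finset.mul_sum]
  refine Finset.sum_congr rfl fun u _ => ?_
  simp only [Pi.smul_apply, smul_eq_mul]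
  ring

/-- The binomial expectation as a linear map. -/
def binELin (N : ℕ) (x : ℝ) : (ℕ → ℝ) →ₗ[ℝ] ℝ where
  toFun := binE N x
  map_add' := binE_add N x
  map_smul' c F := binE_smul N x c F

lemma binE_choose_mul {N j : ℕ} (hj : j ≤ N) (x : ℝ) (G : ℕ → ℝ) :
    binE N x (fun u => (u.choose j : ℝ) * G (u - j)) =
      N.choose j * x ^ j * binE (N - j) x G := by
  obtain ⟨N, rfl⟩ := Nat.exists_eq_add_of_le hj
  rw [binE, binE, add_assoc, Finset.sum_range_add, Finset.sum_eq_zero, zero_add, Finset.mul_sum,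
    Nat.add_sub_cancel_left]
  · refine Finset.sum_congr rfl fun u hu => ?_
    have h := Nat.choose_mul (n := j + N) (k := j + u) (s := j) (by omega)
    rw [Nat.add_sub_cancel_left, Nat.add_sub_cancel_left] at h
    have h' : ((j + N).choose (j + u) : ℝ) * (j + u).choose j = (j + N).choose j * N.choose u := by
      exact_mod_cast h
    rw [Nat.add_sub_cancel_left, Nat.add_sub_add_left, pow_add]
    linear_combination x ^ j * x ^ u * (1 - x) ^ (N - u) * G u * h'
  · intro u hu
    rw [Nat.choose_eq_zero_of_lt (Finset.mem_range.1 hu)]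
    simp

lemma binE_one (N : ℕ) (x : ℝ) : binE N x (fun _ => 1) = 1 := by
  have h := add_pow x (1 - x) N
  rw [add_sub_cancel, one_pow] at h
  rw [binE]
  refine Eq.trans ?_ h.symm
  exact Finset.sum_congr rfl fun u _ => by ring

lemma binE_choose (N s : ℕ) (x : ℝ) :
    binE N x (fun u => (u.choose s : ℝ)) = N.choose s * x ^ s := by
  rcases le_or_gt s N with h | h
  · have := binE_choose_mul h x (fun _ => 1)
    simpa [binE_one] using this
  · rw [Nat.choose_eq_zero_of_lt h, binE]
    simp only [Nat.cast_zero, zero_mul]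
    refine Finset.sum_eq_zero fun u hu => ?_
    rw [Nat.choose_eq_zero_of_lt (n := u) (k := s) (by have := Finset.mem_range.1 hu; omega)]
    simp

/-- The contribution, up to sign, of the positive integers to `binE (m + r + 1) x (nodeFun r)`. -/
def tailSum (r m : ℕ) (x : ℝ) : ℝ :=
  x ^ (r + 1) * ((r + 1) * ((m + r + 1).choose m) / (((r : ℝ) + 2) * (r + 3))) *
    ∑ w ∈ Finset.range (m + 1), (m.choose w : ℝ) * x ^ w * (1 - x) ^ (m - w) *
      (((w : ℝ) - 1) * (w - 2)) / (r + 1 + w)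

lemma sub_one_mul_sub_two_nonneg (w : ℕ) : 0 ≤ ((w : ℝ) - 1) * (w - 2) := by
  rcases w with _ | _ | w
  · norm_num
  · norm_num
  · push_cast
    have : (0 : ℝ) ≤ w := w.cast_nonneg
    nlinarith

lemma tailSum_nonneg (r m : ℕ) {x : ℝ} (h0 : 0 ≤ x) (h1 : x ≤ 1) : 0 ≤ tailSum r m x := by
  have : 0 ≤ 1 - x := by linarith
  refine mul_nonneg (by positivity) (Finset.sum_nonneg fun w _ => ?_)
  have := sub_one_mul_sub_two_nonneg w
  positivity

lemma choose_mul_choose_mul (r m w : ℕ) (hw : w ≤ m) :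
    ((r + w).choose r : ℝ) * (m + r + 1).choose (r + 1 + w) * (r + 1 + w) =
      (r + 1) * (m + r + 1).choose m * m.choose w := by
  have h1 := Nat.add_one_mul_choose_eq (r + w) r
  have h2 := Nat.choose_mul (n := m + r + 1) (k := r + 1 + w) (s := r + 1) (by omega)
  rw [Nat.add_sub_cancel_left, show m + r + 1 - (r + 1) = m by omega] at h2
  have h3 : (m + r + 1).choose (r + 1) = (m + r + 1).choose m := by
    rw [← Nat.choose_symm (by omega : r + 1 ≤ m + r + 1)]
    congr 1
    omega
  rw [h3, show r + 1 + w = r + w + 1 by omega] at h2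
  have h1' : ((r : ℝ) + w + 1) * (r + w).choose r = (r + w + 1).choose (r + 1) * (r + 1) := by
    exact_mod_cast h1
  have h2' : ((m + r + 1).choose (r + w + 1) : ℝ) * (r + w + 1).choose (r + 1) =
      (m + r + 1).choose m * m.choose w := by exact_mod_cast h2
  rw [show r + 1 + w = r + w + 1 by omega]
  linear_combination ((m + r + 1).choose (r + w + 1) : ℝ) * h1' + ((r : ℝ) + 1) * h2'

lemma binE_nodeFun (r m : ℕ) (x : ℝ) :
    binE (m + r + 1) x (nodeFun r) = (1 - x) ^ (m + r + 1) + (-1) ^ r * tailSum r m x := by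
  rw [binE, show m + r + 1 + 1 = (r + 1) + (m + 1) by omega, Finset.sum_range_add,
    Finset.sum_range_succ', Finset.sum_eq_zero, zero_add]
  · congr 1
    · simp [nodeFun_zero]
    · rw [tailSum, ← mul_assoc, Finset.mul_sum]
      refine Finset.sum_congr rfl fun w hw => ?_
      have hw' : w ≤ m := by have := Finset.mem_range.1 hw; omega
      have h := choose_mul_choose_mul r m w hw'
      rw [nodeFun_add, show m + r + 1 - (r + 1 + w) = m - w by omega, pow_add]
      have hpos : (0 : ℝ) < r + 1 + w := by positivity
      field_simp
      linear_combination ((w : ℝ) - 1) * (w - 2) * x ^ (r + 1) * x ^ w * (1 - x) ^ (m - w) * h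
  · intro u hu
    rw [nodeFun_eq_zero (by omega) (by have := Finset.mem_range.1 hu; omega), mul_zero]

lemma choose_add_two (r m : ℕ) :
    ((m + r + 3).choose m : ℝ) * ((r + 3) * (r + 2)) =
      (m + r + 1).choose m * ((m + r + 3) * (m + r + 2)) := by
  have h1 := Nat.choose_mul_succ_eq (m + r + 1) m
  have h2 := Nat.choose_mul_succ_eq (m + r + 2) m
  rw [show m + r + 1 + 1 - m = r + 2 by omega] at h1
  rw [show m + r + 2 + 1 - m = r + 3 by omega] at h2
  have h1' : ((m + r + 1).choose m : ℝ) * (m + r + 1 + 1) = (m + r + 2).choose m * (r + 2) := by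
    exact_mod_cast h1
  have h2' : ((m + r + 2).choose m : ℝ) * (m + r + 2 + 1) = (m + r + 3).choose m * (r + 3) := by
    exact_mod_cast h2
  linear_combination -((r : ℝ) + 2) * h2' - (m + r + 3 : ℝ) * h1'

lemma tailSum_step_of_le {r m : ℕ} {x : ℝ} (h0 : 0 ≤ x) (h1 : x ≤ 1)
    (h : ((m : ℝ) + r + 1) * (m + r + 2) * (r + 3) * x ^ 2 ≤
      (1 - x) ^ 2 * ((r + 1) * (r + 4) * (r + 5))) :
    tailSum (r + 2) m x ≤ (1 - x) ^ 2 * tailSum r m x := by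
  have hx : 0 ≤ 1 - x := by linarith
  rw [tailSum, tailSum]
  set A := ∑ w ∈ Finset.range (m + 1), (m.choose w : ℝ) * x ^ w * (1 - x) ^ (m - w) *
      (((w : ℝ) - 1) * (w - 2)) / (r + 1 + w) with hA
  have hA0 : 0 ≤ A := Finset.sum_nonneg fun w _ => by
    have := sub_one_mul_sub_two_nonneg w
    positivity
  have hB : ∑ w ∈ Finset.range (m + 1), (m.choose w : ℝ) * x ^ w * (1 - x) ^ (m - w) *
      (((w : ℝ) - 1) * (w - 2)) / (((r + 2 : ℕ) : ℝ) + 1 + w) ≤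
      (m + r + 1) / (m + r + 3) * A := by
    rw [hA, Finset.mul_sum]
    refine Finset.sum_le_sum fun w hw => ?_
    have hw' : (w : ℝ) ≤ m := by
      have := Finset.mem_range.1 hw
      exact_mod_cast Nat.lt_succ_iff.1 this
    have h3 := sub_one_mul_sub_two_nonneg w
    have h4 : 0 ≤ (m.choose w : ℝ) * x ^ w * (1 - x) ^ (m - w) * (((w : ℝ) - 1) * (w - 2)) := by
      positivity
    push_cast
    rw [div_mul_div_comm, div_le_div_iff₀ (by positivity) (by positivity)]
    have h5 : ((m : ℝ) + r + 3) * (r + 1 + w) ≤ (m + r + 1) * (r + 2 + 1 + w) := by nlinarith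
    nlinarith [mul_le_mul_of_nonneg_left h5 h4]
  refine (mul_le_mul_of_nonneg_left hB (by positivity)).trans ?_
  have hc := choose_add_two r m
  have hc' : ((m + (r + 2) + 1).choose m : ℝ) =
      (m + r + 1).choose m * ((m + r + 3) * (m + r + 2)) / ((r + 3) * (r + 2)) := by
    rw [show m + (r + 2) + 1 = m + r + 3 by omega]
    field_simp
    linarith
  rw [hc']
  push_cast
  have e1 : x ^ (r + 2 + 1) * ((↑r + 2 + 1) * (((m + r + 1).choose m : ℝ) *
      ((↑m + ↑r + 3) * (↑m + ↑r + 2)) / ((↑r + 3) * (↑r + 2))) / ((↑r + 2 + 2) * (↑r + 2 + 3))) *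
      ((↑m + ↑r + 1) / (↑m + ↑r + 3) * A) =
      (x ^ (r + 1) * ((m + r + 1).choose m : ℝ) * A /
        ((r + 2) * (r + 3) * ((r + 4) * (r + 5)))) *
        (((m : ℝ) + r + 1) * (m + r + 2) * (r + 3) * x ^ 2) := by
    rw [show (r : ℝ) + 2 + 2 = r + 4 by ring, show (r : ℝ) + 2 + 3 = r + 5 by ring]
    field_simp
    ring
  have e2 : (1 - x) ^ 2 * (x ^ (r + 1) * ((↑r + 1) * ((m + r + 1).choose m : ℝ) /
      ((↑r + 2) * (↑r + 3))) * A) =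
      (x ^ (r + 1) * ((m + r + 1).choose m : ℝ) * A /
        ((r + 2) * (r + 3) * ((r + 4) * (r + 5)))) *
        ((1 - x) ^ 2 * ((r + 1) * (r + 4) * (r + 5))) := by
    field_simp
  rw [e1, e2]
  exact mul_le_mul_of_nonneg_left h (by positivity)

lemma tailSum_step {r m : ℕ} (hr : Odd r) (hm : 3 ≤ m) {x : ℝ} (h0 : 0 ≤ x)
    (h1 : x ≤ 4 / (2 * m + 3)) : tailSum (r + 2) m x ≤ (1 - x) ^ 2 * tailSum r m x := by
  have hm' : (3 : ℝ) ≤ m := by exact_mod_cast hm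
  have hx1 : x ≤ 1 := h1.trans (by rw [div_le_one (by linarith)]; linarith)
  rw [le_div_iff₀ (by linarith)] at h1
  by_cases hc : m = 3 ∧ r = 1
  · obtain ⟨rfl, rfl⟩ := hc
    norm_num at h1
    norm_num [tailSum, Finset.sum_range_succ, Nat.choose]
    have hy : 0 ≤ 1 - x := by linarith
    have h2 : x ≤ 4 / 5 * (1 - x) := by linarith
    generalize 1 - x = y at hy h2 ⊢
    have h3 : x ^ 2 ≤ (4 / 5 * y) ^ 2 := pow_le_pow_left₀ h0 h2 2
    have h4 : x ^ 3 ≤ (4 / 5 * y) ^ 3 := pow_le_pow_left₀ h0 h2 3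
    have h5 : 14 / 3 * x ^ 2 * (y ^ 3 / 2 + 2 * x ^ 3 / 7) ≤
        5 / 3 * y ^ 2 * (y ^ 3 + 2 / 5 * x ^ 3) := by
      have h6 : 0 ≤ y ^ 3 / 2 + 2 * x ^ 3 / 7 := by positivity
      have h7 := mul_le_mul_of_nonneg_right h3 h6
      have h8 := mul_le_mul_of_nonneg_left h4 (sq_nonneg y)
      have h9 : 0 ≤ y ^ 5 := pow_nonneg hy 5
      nlinarith
    have h6 := mul_le_mul_of_nonneg_left h5 (sq_nonneg x)
    linarith
  · have key : 16 * (((m : ℝ) + r + 1) * (m + r + 2) * (r + 3)) ≤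
        (2 * m - 1) ^ 2 * ((r + 1) * (r + 4) * (r + 5)) := by
      rcases Nat.lt_or_ge m 4 with h | h
      · obtain rfl : m = 3 := by omega
        obtain ⟨b, rfl⟩ : ∃ b, r = 3 + b :=
          ⟨r - 3, by obtain ⟨a, rfl⟩ := hr; omega⟩
        push_cast
        rw [← sub_nonneg]
        ring_nf
        positivity
      · obtain ⟨b, rfl⟩ : ∃ b, r = 1 + b := ⟨r - 1, by have := hr.pos; omega⟩
        obtain ⟨a, rfl⟩ : ∃ a, m = 4 + a := ⟨m - 4, by omega⟩
        rw [← sub_nonneg]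
        push_cast
        ring_nf
        positivity
    apply tailSum_step_of_le h0 hx1
    have h2 : (2 * m - 1) * x ≤ 4 * (1 - x) := by linarith
    have h3 : ((2 * m - 1) * x) ^ 2 ≤ (4 * (1 - x)) ^ 2 := by
      apply pow_le_pow_left₀ _ h2
      apply mul_nonneg _ h0
      linarith
    have h4 : 0 ≤ ((r : ℝ) + 1) * (r + 4) * (r + 5) := by positivity
    nlinarith [mul_le_mul_of_nonneg_right h3 h4, mul_le_mul_of_nonneg_right key (sq_nonneg x)]

lemma binE_nodeFun_pos_of_even {r : ℕ} (hr : Even r) (m : ℕ) {x : ℝ} (h0 : 0 ≤ x) (h1 : x < 1) :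
    0 < binE (m + r + 1) x (nodeFun r) := by
  rw [binE_nodeFun, hr.neg_one_pow, one_mul]
  have := tailSum_nonneg r m h0 h1.le
  have h2 : 0 < (1 - x) ^ (m + r + 1) := pow_pos (by linarith) _
  linarith

lemma binE_nodeFun_nonneg_of_odd {m : ℕ} (hm : 3 ≤ m) {x : ℝ} (h0 : 0 ≤ x)
    (h1 : x ≤ 4 / (2 * m + 3)) (h : 0 ≤ binE (m + 2) x (nodeFun 1)) {r : ℕ} (hr : Odd r) :
    0 ≤ binE (m + r + 1) x (nodeFun r) := by
  obtain ⟨a, rfl⟩ := hr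
  induction a with
  | zero => exact h
  | succ a ih =>
    have ho : Odd (2 * a + 1) := ⟨a, rfl⟩
    have hs := tailSum_step ho hm h0 h1
    rw [binE_nodeFun, ho.neg_one_pow] at ih
    have ho' : Odd (2 * (a + 1) + 1) := ⟨a + 1, rfl⟩
    rw [binE_nodeFun, ho'.neg_one_pow, show 2 * (a + 1) + 1 = 2 * a + 1 + 2 by ring]
    have h2 := mul_nonneg (sq_nonneg (1 - x)) ih
    have h3 : (1 - x) ^ (m + (2 * a + 1 + 2) + 1) = (1 - x) ^ 2 * (1 - x) ^ (m + (2 * a + 1) + 1) := by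
      ring
    rw [h3]
    linarith

lemma nodeFun_eq (r : ℕ) : nodeFun r =
    ∑ s ∈ Finset.range (r + 3), (-1 : ℝ) ^ s • (fun v : ℕ => (v.choose s : ℝ)) +
    ((-1) ^ r * (2 / (((r : ℝ) + 2) * (r + 3)))) •
      ((fun v : ℕ => (v.choose (r + 1) : ℝ)) -
        ((r : ℝ) + 2) • (fun v : ℕ => (v.choose (r + 2) : ℝ))) := by
  ext v
  simp [nodeFun]

lemma binE_nodeFun_eq_sum (N r : ℕ) (x : ℝ) : binE N x (nodeFun r) =
    ∑ s ∈ Finset.range (r + 3), (-1 : ℝ) ^ s * ((N.choose s : ℝ) * x ^ s) +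
    ((-1) ^ r * (2 / (((r : ℝ) + 2) * (r + 3)))) *
      ((N.choose (r + 1) : ℝ) * x ^ (r + 1) - (r + 2) * ((N.choose (r + 2) : ℝ) * x ^ (r + 2))) := by
  have h (F : ℕ → ℝ) : binE N x F = binELin N x F := rfl
  have hc (s : ℕ) : binELin N x (fun v : ℕ => (v.choose s : ℝ)) = N.choose s * x ^ s :=
    binE_choose N s x
  rw [h, nodeFun_eq, map_add, map_sum, map_smul, map_sub, map_smul, hc, hc]
  simp only [map_smul, hc, smul_eq_mul]

/-- The functions on `ℕ` of degree at most `K + 2` dual to evaluation at the points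
`0, …, K, K + 2, K + 3`. -/
def fundFun (K j u : ℕ) : ℝ :=
  if j ≤ K then (u.choose j : ℝ) * nodeFun (K - j) (u - j)
  else if j = K + 2 then
    1 / ((K : ℝ) + 2) * (2 * (u.choose (K + 1) : ℝ) - (K + 2) * (u.choose (K + 2) : ℝ))
  else if j = K + 3 then
    2 / (((K : ℝ) + 2) * (K + 3)) * ((K + 2) * (u.choose (K + 2) : ℝ) - (u.choose (K + 1) : ℝ))
  else 0

lemma cast_choose_succ_left (a : ℕ) : ((a + 2).choose a : ℝ) = (a + 2) * (a + 1) / 2 := by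
  rw [Nat.choose_symm_add, Nat.cast_choose_two]
  push_cast
  ring

/-- The points `0, …, K, K + 2, K + 3`. -/
def nodes (K : ℕ) : Finset ℕ := (Finset.range (K + 4)).erase (K + 1)

lemma mem_nodes {K u : ℕ} : u ∈ nodes K ↔ u ≤ K ∨ u = K + 2 ∨ u = K + 3 := by
  simp only [nodes, Finset.mem_erase, Finset.mem_range]
  omega

lemma card_nodes (K : ℕ) : (nodes K).card = K + 3 := by
  rw [nodes, Finset.card_erase_of_mem (by simp)]
  simp

lemma fundFun_of_le {K j u : ℕ} (hj : j ≤ K) (hu : u ∈ nodes K) :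
    fundFun K j u = if j = u then 1 else 0 := by
  rw [fundFun, if_pos hj]
  split_ifs with h
  · subst h
    simp [nodeFun_zero]
  · rcases lt_or_gt_of_ne h with h | h
    · rw [mem_nodes] at hu
      rcases hu with hu | rfl | rfl
      · rw [nodeFun_eq_zero (by omega) (by omega), mul_zero]
      · rw [show K + 2 - j = K - j + 1 + 1 by omega, nodeFun_add]
        simp
      · rw [show K + 3 - j = K - j + 1 + 2 by omega, nodeFun_add]
        simp
    · rw [Nat.choose_eq_zero_of_lt h]
      simp

lemma fundFun_of_mem {K j u : ℕ} (hj : j ∈ nodes K) (hu : u ∈ nodes K) :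
    fundFun K j u = if j = u then 1 else 0 := by
  rcases mem_nodes.1 hj with h | rfl | rfl
  · exact fundFun_of_le h hu
  · have hK : (0 : ℝ) < (K : ℝ) + 2 := by positivity
    rw [fundFun, if_neg (by omega), if_pos rfl]
    rcases mem_nodes.1 hu with h | rfl | rfl
    · rw [Nat.choose_eq_zero_of_lt (by omega), Nat.choose_eq_zero_of_lt (by omega),
        if_neg (by omega)]
      simp
    · rw [Nat.choose_succ_self_right, Nat.choose_self, if_pos rfl]
      push_cast
      field_simp
      ring
    · rw [Nat.choose_succ_self_right, cast_choose_succ_left (K + 1), if_neg (by omega)]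
      push_cast
      field_simp
      ring
  · have hK : (0 : ℝ) < (K : ℝ) + 2 := by positivity
    rw [fundFun, if_neg (by omega), if_neg (by omega), if_pos rfl]
    rcases mem_nodes.1 hu with h | rfl | rfl
    · rw [Nat.choose_eq_zero_of_lt (by omega), Nat.choose_eq_zero_of_lt (by omega),
        if_neg (by omega)]
      simp
    · rw [Nat.choose_succ_self_right, Nat.choose_self, if_neg (by omega)]
      push_cast
      field_simp
      ring
    · rw [Nat.choose_succ_self_right, cast_choose_succ_left (K + 1), if_pos rfl]
      push_cast
      field_simp
      ring

lemma fundFun_of_notMem {K j : ℕ} (hj : j ∉ nodes K) : fundFun K j = 0 := by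
  rw [mem_nodes] at hj
  push Not at hj
  ext u
  rw [fundFun, if_neg (by omega), if_neg hj.2.1, if_neg hj.2.2]
  rfl

/-- The space of functions on `ℕ` spanned by the binomial coefficients `u ↦ C(u, s)`, `s ≤ k`. -/
def chooseSpan (k : ℕ) : Submodule ℝ (ℕ → ℝ) :=
  Submodule.span ℝ ((fun s u : ℕ => (u.choose s : ℝ)) '' Set.Iic k)

lemma choose_mem_chooseSpan {k s : ℕ} (h : s ≤ k) :
    (fun u : ℕ => (u.choose s : ℝ)) ∈ chooseSpan k :=
  Submodule.subset_span ⟨s, h, rfl⟩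

lemma exists_polynomial_of_mem_chooseSpan {k : ℕ} {F : ℕ → ℝ} (hF : F ∈ chooseSpan k) :
    ∃ P : Polynomial ℝ, P.degree < (k + 1 : ℕ) ∧ ∀ u : ℕ, F u = P.eval (u : ℝ) := by
  induction hF using Submodule.span_induction with
  | mem F hF =>
    obtain ⟨s, hs, rfl⟩ := hF
    refine ⟨Polynomial.C ((s.factorial : ℝ)⁻¹) * descPochhammer ℝ s, ?_, fun u => ?_⟩
    · rw [Polynomial.degree_C_mul (inv_ne_zero (by exact_mod_cast s.factorial_ne_zero))]
      refine Polynomial.degree_le_natDegree.trans_lt ?_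
      rw [descPochhammer_natDegree]
      exact_mod_cast Nat.lt_succ_of_le hs
    · rw [Polynomial.eval_C_mul, descPochhammer_eval_eq_descFactorial,
        Nat.descFactorial_eq_factorial_mul_choose]
      have : (s.factorial : ℝ) ≠ 0 := by exact_mod_cast s.factorial_ne_zero
      push_cast
      field_simp
  | zero => exact ⟨0, by simp, by simp⟩
  | add F G _ _ hF hG =>
    obtain ⟨P, hP, hP'⟩ := hF
    obtain ⟨Q, hQ, hQ'⟩ := hG
    exact ⟨P + Q, (Polynomial.degree_add_le _ _).trans_lt (max_lt hP hQ), by simp [hP', hQ']⟩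
  | smul c F _ hF =>
    obtain ⟨P, hP, hP'⟩ := hF
    exact ⟨c • P, (Polynomial.degree_smul_le _ _).trans_lt hP, by simp [hP']⟩

lemma eq_zero_of_mem_chooseSpan {k : ℕ} {F : ℕ → ℝ} (hF : F ∈ chooseSpan k) {S : Finset ℕ}
    (hS : k + 1 ≤ S.card) (h : ∀ u ∈ S, F u = 0) : F = 0 := by
  obtain ⟨P, hP, hP'⟩ := exists_polynomial_of_mem_chooseSpan hF
  have : P = 0 := by
    refine Polynomial.eq_zero_of_degree_lt_of_eval_finset_eq_zero
      (S.map (Nat.castEmbedding (R := ℝ))) (hP.trans_le ?_) ?_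
    · rw [Finset.card_map]
      exact_mod_cast hS
    · intro y hy
      obtain ⟨u, hu, rfl⟩ := Finset.mem_map.1 hy
      rw [← h u hu, hP']
      rfl
  ext u
  simp [hP', this]

lemma choose_mul_choose_sub (u j s : ℕ) :
    (u.choose j : ℝ) * (u - j).choose s = ((j + s).choose j : ℝ) * u.choose (j + s) := by
  have h := Nat.choose_mul (n := u) (k := j + s) (s := j) (by omega)
  rw [Nat.add_sub_cancel_left, mul_comm] at h
  exact_mod_cast h.symm

lemma fundFun_mem_chooseSpan (K j : ℕ) : fundFun K j ∈ chooseSpan (K + 2) := by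
  by_cases h1 : j ≤ K
  · have e : fundFun K j = fun u => (u.choose j : ℝ) * nodeFun (K - j) (u - j) := by
      ext u
      rw [fundFun, if_pos h1]
    have h (s : ℕ) (hs : s ≤ K - j + 2) :
        (fun u : ℕ => (u.choose j : ℝ) * (u - j).choose s) ∈ chooseSpan (K + 2) := by
      have : (fun u : ℕ => (u.choose j : ℝ) * (u - j).choose s) =
          ((j + s).choose j : ℝ) • (fun u : ℕ => (u.choose (j + s) : ℝ)) := by
        ext u
        exact choose_mul_choose_sub u j s
      rw [this]
      exact Submodule.smul_mem _ _ (choose_mem_chooseSpan (by omega))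
    rw [e]
    have e2 : (fun u : ℕ => (u.choose j : ℝ) * nodeFun (K - j) (u - j)) =
        ∑ s ∈ Finset.range (K - j + 3),
          (-1 : ℝ) ^ s • (fun u : ℕ => (u.choose j : ℝ) * (u - j).choose s) +
        ((-1) ^ (K - j) * (2 / ((((K - j : ℕ) : ℝ) + 2) * ((K - j : ℕ) + 3)))) •
          ((fun u : ℕ => (u.choose j : ℝ) * (u - j).choose (K - j + 1)) -
            (((K - j : ℕ) : ℝ) + 2) •
              (fun u : ℕ => (u.choose j : ℝ) * (u - j).choose (K - j + 2))) := by
      ext u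
      simp only [nodeFun, Pi.add_apply, Pi.sub_apply, Pi.smul_apply, Finset.sum_apply, smul_eq_mul,
        mul_add, Finset.mul_sum]
      congr 1
      · exact Finset.sum_congr rfl fun s _ => by ring
      · ring
    rw [e2]
    refine Submodule.add_mem _ (Submodule.sum_mem _ fun s hs => Submodule.smul_mem _ _ (h s ?_))
      (Submodule.smul_mem _ _ (Submodule.sub_mem _ (h _ (by omega))
        (Submodule.smul_mem _ _ (h _ (by omega)))))
    have := Finset.mem_range.1 hs
    omega
  · have c1 : (fun u : ℕ => (u.choose (K + 1) : ℝ)) ∈ chooseSpan (K + 2) :=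
      choose_mem_chooseSpan (by omega)
    have c2 : (fun u : ℕ => (u.choose (K + 2) : ℝ)) ∈ chooseSpan (K + 2) :=
      choose_mem_chooseSpan le_rfl
    by_cases h2 : j = K + 2
    · have e : fundFun K j = (1 / ((K : ℝ) + 2)) • ((2 : ℝ) • (fun u : ℕ => (u.choose (K + 1) : ℝ)) -
          ((K : ℝ) + 2) • (fun u : ℕ => (u.choose (K + 2) : ℝ))) := by
        ext u
        rw [fundFun, if_neg h1, if_pos h2]
        rfl
      rw [e]
      exact Submodule.smul_mem _ _ (Submodule.sub_mem _ (Submodule.smul_mem _ _ c1)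
        (Submodule.smul_mem _ _ c2))
    · by_cases h3 : j = K + 3
      · have e : fundFun K j = (2 / (((K : ℝ) + 2) * (K + 3))) •
            (((K : ℝ) + 2) • (fun u : ℕ => (u.choose (K + 2) : ℝ)) -
              (fun u : ℕ => (u.choose (K + 1) : ℝ))) := by
          ext u
          rw [fundFun, if_neg h1, if_neg h2, if_pos h3]
          rfl
        rw [e]
        exact Submodule.smul_mem _ _ (Submodule.sub_mem _ (Submodule.smul_mem _ _ c2) c1)
      · rw [fundFun_of_notMem (by rw [mem_nodes]; omega)]
        exact Submodule.zero_mem _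

lemma sum_fundFun_mul_choose {K n s : ℕ} (hn : K + 3 ≤ n) (hs : s ≤ K + 2) :
    ∑ j ∈ Finset.range (n + 1), (j.choose s : ℝ) • fundFun K j =
      fun u : ℕ => (u.choose s : ℝ) := by
  rw [← sub_eq_zero]
  refine eq_zero_of_mem_chooseSpan (k := K + 2) (S := nodes K) ?_ (card_nodes K).ge ?_
  · exact Submodule.sub_mem _ (Submodule.sum_mem _ fun j _ => Submodule.smul_mem _ _
      (fundFun_mem_chooseSpan K j)) (choose_mem_chooseSpan hs)
  · intro u hu
    simp only [Pi.sub_apply, Finset.sum_apply, Pi.smul_apply, smul_eq_mul]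
    rw [Finset.sum_eq_single u, fundFun_of_mem hu hu, if_pos rfl, mul_one, sub_self]
    · intro j _ hju
      by_cases hj : j ∈ nodes K
      · rw [fundFun_of_mem hj hu, if_neg hju, mul_zero]
      · rw [fundFun_of_notMem hj, Pi.zero_apply, mul_zero]
    · intro h
      rw [mem_nodes] at hu
      simp only [Finset.mem_range] at h
      omega

lemma sum_binE_fundFun_mul_choose {K n s : ℕ} (hn : K + 3 ≤ n) (hs : s ≤ K + 2) (x : ℝ) :
    ∑ j ∈ Finset.range (n + 1), (j.choose s : ℝ) * binE n x (fundFun K j) =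
      n.choose s * x ^ s := by
  have h := congrArg (binELin n x) (sum_fundFun_mul_choose hn hs)
  simp only [map_sum, map_smul, smul_eq_mul] at h
  exact h.trans (binE_choose n s x)

lemma binE_fundFun_of_le {K j n : ℕ} (hj : j ≤ K) (hn : j ≤ n) (x : ℝ) :
    binE n x (fundFun K j) = n.choose j * x ^ j * binE (n - j) x (nodeFun (K - j)) := by
  rw [← binE_choose_mul hn]
  congr 1
  ext u
  rw [fundFun, if_pos hj]

lemma cast_choose_succ_mul (a d : ℕ) :
    ((a + d).choose (a + 1) : ℝ) * (a + 1) = (a + d).choose a * d := by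
  have := Nat.choose_succ_right_eq (a + d) a
  rw [Nat.add_sub_cancel_left] at this
  exact_mod_cast this

lemma binE_fundFun_nonneg {K d : ℕ} (hd : 2 ≤ d) {x : ℝ} (h0 : 0 ≤ x)
    (h1 : 1 ≤ (d + 1) * x) (h2 : x ≤ 4 / (2 * (d + 1 : ℕ) + 3))
    (h : 0 ≤ binE (d + 3) x (nodeFun 1)) (j : ℕ) :
    0 ≤ binE (K + 2 + d) x (fundFun K j) := by
  have hd' : (2 : ℝ) ≤ d := by exact_mod_cast hd
  have hx := h2
  push_cast at hx
  rw [le_div_iff₀ (by linarith)] at hx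
  have hx1 : x < 1 := by nlinarith
  have hc := cast_choose_succ_mul (K + 1) (d + 1)
  rw [show K + 1 + (d + 1) = K + 2 + d by ring, show K + 1 + 1 = K + 2 by ring] at hc
  push_cast at hc
  by_cases hj : j ∈ nodes K
  · rcases mem_nodes.1 hj with h3 | rfl | rfl
    · rw [binE_fundFun_of_le h3 (by omega)]
      refine mul_nonneg (by positivity) ?_
      rw [show K + 2 + d - j = d + 1 + (K - j) + 1 by omega]
      rcases Nat.even_or_odd (K - j) with he | ho
      · exact (binE_nodeFun_pos_of_even he _ h0 hx1).le
      · exact binE_nodeFun_nonneg_of_odd (by omega) h0 h2 h ho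
    · have e : fundFun K (K + 2) = (1 / ((K : ℝ) + 2)) •
          ((2 : ℝ) • (fun u : ℕ => (u.choose (K + 1) : ℝ)) -
          ((K : ℝ) + 2) • (fun u : ℕ => (u.choose (K + 2) : ℝ))) := by
        ext u
        rw [fundFun, if_neg (by omega), if_pos rfl]
        rfl
      change 0 ≤ binELin (K + 2 + d) x _
      have hcc (s : ℕ) : binELin (K + 2 + d) x (fun v : ℕ => (v.choose s : ℝ)) =
        (K + 2 + d).choose s * x ^ s := binE_choose _ s x
      rw [e, map_smul, map_sub, map_smul, map_smul, hcc, hcc]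
      simp only [smul_eq_mul]
      have h3 : 2 * (((K + 2 + d).choose (K + 1) : ℝ) * x ^ (K + 1)) -
          (K + 2) * (((K + 2 + d).choose (K + 2) : ℝ) * x ^ (K + 2)) =
          ((K + 2 + d).choose (K + 1) : ℝ) * x ^ (K + 1) * (2 - (d + 1) * x) := by
        linear_combination -x ^ (K + 2) * hc
      rw [h3]
      have : 0 ≤ 2 - (d + 1) * x := by linarith
      positivity
    · have e : fundFun K (K + 3) = (2 / (((K : ℝ) + 2) * (K + 3))) •
            (((K : ℝ) + 2) • (fun u : ℕ => (u.choose (K + 2) : ℝ)) -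
              (fun u : ℕ => (u.choose (K + 1) : ℝ))) := by
        ext u
        rw [fundFun, if_neg (by omega), if_neg (by omega), if_pos rfl]
        rfl
      change 0 ≤ binELin (K + 2 + d) x _
      have hcc (s : ℕ) : binELin (K + 2 + d) x (fun v : ℕ => (v.choose s : ℝ)) =
        (K + 2 + d).choose s * x ^ s := binE_choose _ s x
      rw [e, map_smul, map_sub, map_smul, hcc, hcc]
      simp only [smul_eq_mul]
      have h3 : (K + 2) * (((K + 2 + d).choose (K + 2) : ℝ) * x ^ (K + 2)) -
          ((K + 2 + d).choose (K + 1) : ℝ) * x ^ (K + 1) =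
          ((K + 2 + d).choose (K + 1) : ℝ) * x ^ (K + 1) * ((d + 1) * x - 1) := by
        linear_combination x ^ (K + 2) * hc
      rw [h3]
      have : 0 ≤ (d + 1) * x - 1 := by linarith
      positivity
  · rw [fundFun_of_notMem hj]
    exact (map_zero (binELin (K + 2 + d) x)).ge

/-- The set of coordinates at which `x` is `0`. -/
def zeros {n : ℕ} (x : Fin n → Bool) : Finset (Fin n) := Finset.univ.filter fun i => x i = false

lemma prAll_eq_sum {n : ℕ} (f : (Fin n → Bool) → ℝ) (S : Finset (Fin n)) :
    prAll f S = ∑ x, f x * ∏ i ∈ S, if x i = true then 1 else 0 := by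
  rw [prAll, Finset.sum_filter]
  refine Finset.sum_congr rfl fun x _ => ?_
  rw [Finset.prod_boole]
  simp

lemma sum_mul_prod_one_sub {Ω ι : Type*} [Fintype Ω] (f : Ω → ℝ) (a : Ω → ι → ℝ) (c : ℝ)
    (T : Finset ι) (h : ∀ U ⊆ T, ∑ x, f x * ∏ i ∈ U, a x i = c ^ U.card) :
    ∑ x, f x * ∏ i ∈ T, (1 - a x i) = (1 - c) ^ T.card := by
  have e (b : ι → ℝ) : ∏ i ∈ T, (1 - b i) =
      ∑ U ∈ T.powerset, (-1) ^ U.card * ∏ i ∈ U, b i := by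
    simp_rw [sub_eq_add_neg]
    rw [Finset.prod_one_add]
    exact Finset.sum_congr rfl fun U _ => Finset.prod_neg _
  rw [← Finset.prod_const, e]
  simp_rw [e, Finset.mul_sum]
  rw [Finset.sum_comm]
  refine Finset.sum_congr rfl fun U hU => ?_
  rw [Finset.prod_const, ← h U (Finset.mem_powerset.1 hU), Finset.mul_sum]
  exact Finset.sum_congr rfl fun x _ => by ring

lemma sum_mul_prod_isZero {n k : ℕ} {p : ℝ} {f : (Fin n → Bool) → ℝ} (hf : memA n k p f)
    {T : Finset (Fin n)} (hT : T.card ≤ k) :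
    ∑ x, f x * ∏ i ∈ T, (if x i = false then 1 else 0) = (1 - p) ^ T.card := by
  rw [← sum_mul_prod_one_sub f (fun x i => if x i = true then 1 else 0) p T]
  · refine Finset.sum_congr rfl fun x _ => ?_
    congr 1
    refine Finset.prod_congr rfl fun i _ => ?_
    cases x i <;> simp
  · intro U hU
    rcases U.eq_empty_or_nonempty with rfl | hne
    · simpa using hf.2.1
    · rw [← prAll_eq_sum]
      exact hf.2.2 U (Finset.card_pos.2 hne) ((Finset.card_le_card hU).trans hT)

lemma prod_isZero {n : ℕ} (x : Fin n → Bool) (T : Finset (Fin n)) :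
    ∏ i ∈ T, (if x i = false then (1 : ℝ) else 0) = if T ⊆ zeros x then 1 else 0 := by
  rw [Finset.prod_boole]
  simp [zeros, Finset.subset_iff]

lemma choose_card_zeros {n : ℕ} (x : Fin n → Bool) (s : ℕ) :
    ((zeros x).card.choose s : ℝ) =
      ∑ T ∈ Finset.powersetCard s (Finset.univ : Finset (Fin n)),
        ∏ i ∈ T, (if x i = false then (1 : ℝ) else 0) := by
  simp_rw [prod_isZero]
  rw [← Finset.card_powersetCard, Finset.sum_boole]
  congr 2
  ext T
  simp [Finset.mem_powersetCard, and_comm]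

lemma sum_mul_eq_binE {n k : ℕ} {p : ℝ} {f : (Fin n → Bool) → ℝ} (hf : memA n k p f)
    {F : ℕ → ℝ} (hF : F ∈ chooseSpan k) :
    ∑ x, f x * F (zeros x).card = binE n (1 - p) F := by
  induction hF using Submodule.span_induction with
  | mem F hF =>
    obtain ⟨s, hs, rfl⟩ := hF
    rw [binE_choose]
    simp_rw [choose_card_zeros, Finset.mul_sum]
    rw [Finset.sum_comm]
    rw [Finset.sum_congr rfl fun T hT => (sum_mul_prod_isZero hf
      ((Finset.mem_powersetCard.1 hT).2.trans_le hs)).trans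
        (by rw [(Finset.mem_powersetCard.1 hT).2])]
    simp
  | zero => exact (by simp : _ = (0 : ℝ)).trans (map_zero (binELin n (1 - p))).symm
  | add F G _ _ hF hG =>
    rw [binE_add, ← hF, ← hG, ← Finset.sum_add_distrib]
    exact Finset.sum_congr rfl fun x _ => mul_add _ _ _
  | smul c F _ hF =>
    rw [binE_smul, ← hF, Finset.mul_sum]
    refine Finset.sum_congr rfl fun x _ => ?_
    simp only [Pi.smul_apply, smul_eq_mul]
    ring

lemma card_zeros_eq_zero {n : ℕ} {x : Fin n → Bool} :
    (zeros x).card = 0 ↔ ∀ i, x i = true := by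
  simp [zeros, Finset.filter_eq_empty_iff]

lemma card_zeros_le {n : ℕ} (x : Fin n → Bool) : (zeros x).card ≤ n :=
  (Finset.card_le_univ _).trans_eq (Fintype.card_fin n)

lemma prAll_univ {n : ℕ} (f : (Fin n → Bool) → ℝ) :
    prAll f Finset.univ = ∑ x, f x * if (zeros x).card = 0 then 1 else 0 := by
  rw [prAll, Finset.sum_filter]
  refine Finset.sum_congr rfl fun x _ => ?_
  simp only [Finset.mem_univ, true_imp_iff, card_zeros_eq_zero, mul_ite, mul_one, mul_zero]

lemma prAll_univ_le_binE {n k : ℕ} {p : ℝ} {f : (Fin n → Bool) → ℝ} (hf : memA n k p f)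
    {F : ℕ → ℝ} (hF : F ∈ chooseSpan k) (h0 : 1 ≤ F 0) (h1 : ∀ u, 1 ≤ u → u ≤ n → 0 ≤ F u) :
    prAll f Finset.univ ≤ binE n (1 - p) F := by
  rw [← sum_mul_eq_binE hf hF, prAll_univ]
  refine Finset.sum_le_sum fun x _ => mul_le_mul_of_nonneg_left ?_ (hf.1 x)
  split_ifs with h
  · rwa [h]
  · exact h1 _ (by omega) (card_zeros_le x)

lemma sum_superset_card {n : ℕ} (T : Finset (Fin n)) (φ : ℕ → ℝ) :
    ∑ x : Fin n → Bool, φ (zeros x).card * ∏ i ∈ T, (if x i = false then (1 : ℝ) else 0) =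
      ∑ b ∈ Finset.range (n - T.card + 1), ((n - T.card).choose b : ℝ) * φ (T.card + b) := by
  have h1 := Finset.sum_powerset_apply_card (x := Tᶜ) (fun b => φ (T.card + b))
  rw [Finset.card_compl, Fintype.card_fin] at h1
  simp only [nsmul_eq_mul] at h1
  rw [← h1]
  simp_rw [prod_isZero, mul_ite, mul_one, mul_zero]
  rw [← Finset.sum_filter]
  refine Finset.sum_bij' (fun x _ => zeros x \ T) (fun B _ i => decide (i ∉ T ∪ B)) ?_ ?_ ?_ ?_ ?_
  · intro x _
    rw [Finset.mem_powerset]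
    intro i hi
    rw [Finset.mem_compl]
    exact (Finset.mem_sdiff.1 hi).2
  · intro B _
    simp only [Finset.mem_filter, Finset.mem_univ, true_and]
    intro i hi
    simp [zeros, hi]
  · intro x hx
    simp only [Finset.mem_filter, Finset.mem_univ, true_and] at hx
    ext i
    have := @hx i
    simp only [zeros, Finset.mem_filter, Finset.mem_univ, true_and] at this
    by_cases hi : i ∈ T
    · simp [hi, this hi]
    · cases hxi : x i <;> simp [zeros, hi, hxi]
  · intro B hB
    rw [Finset.mem_powerset] at hB
    ext i
    have := @hB i
    rw [Finset.mem_compl] at this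
    simp only [zeros, Finset.mem_sdiff, Finset.mem_filter, Finset.mem_univ, true_and,
      decide_eq_false_iff_not, not_not, Finset.mem_union]
    tauto
  · intro x hx
    simp only [Finset.mem_filter, Finset.mem_univ, true_and] at hx
    rw [← Finset.card_sdiff_add_card_eq_card hx, add_comm]

/-- The exchangeable mass function for which the number of zeros has mass function `q`. -/
def exchMass (n : ℕ) (q : ℕ → ℝ) (x : Fin n → Bool) : ℝ :=
  q (zeros x).card / n.choose (zeros x).card

lemma sum_exchMass_mul_prod {n : ℕ} (q : ℕ → ℝ) (T : Finset (Fin n)) :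
    (n.choose T.card : ℝ) *
        ∑ x, exchMass n q x * ∏ i ∈ T, (if x i = false then (1 : ℝ) else 0) =
      ∑ j ∈ Finset.range (n + 1), (j.choose T.card : ℝ) * q j := by
  have hT : T.card ≤ n := (Finset.card_le_univ _).trans_eq (Fintype.card_fin n)
  have h := sum_superset_card T (fun j => q j / n.choose j)
  simp only [exchMass]
  rw [h]
  have hz : ∑ u ∈ Finset.range T.card, (u.choose T.card : ℝ) * q u = 0 := by
    refine Finset.sum_eq_zero fun u hu => ?_
    rw [Nat.choose_eq_zero_of_lt (Finset.mem_range.1 hu), Nat.cast_zero, zero_mul]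
  rw [show n + 1 = T.card + (n - T.card + 1) by omega,
    Finset.sum_range_add _ T.card (n - T.card + 1), hz, zero_add, Finset.mul_sum]
  refine Finset.sum_congr rfl fun b hb => ?_
  have hb' := Finset.mem_range.1 hb
  have h1 := Nat.choose_mul (n := n) (k := T.card + b) (s := T.card) (by omega)
  rw [Nat.add_sub_cancel_left] at h1
  have h2 : (n.choose (T.card + b) : ℝ) * (T.card + b).choose T.card =
    n.choose T.card * (n - T.card).choose b := by exact_mod_cast h1
  have h3 : (n.choose (T.card + b) : ℝ) ≠ 0 := by
    exact_mod_cast (Nat.choose_pos (by omega)).ne'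
  field_simp
  linear_combination -q (T.card + b) * h2

lemma memA_exchMass {n k : ℕ} {p : ℝ} {q : ℕ → ℝ} (hq : ∀ j, 0 ≤ q j)
    (h : ∀ s ≤ k, ∑ j ∈ Finset.range (n + 1), (j.choose s : ℝ) * q j =
      n.choose s * (1 - p) ^ s) : memA n k p (exchMass n q) := by
  have h1 (T : Finset (Fin n)) (hT : T.card ≤ k) :
      ∑ x, exchMass n q x * ∏ i ∈ T, (if x i = false then (1 : ℝ) else 0) =
        (1 - p) ^ T.card := by
    have hT' : T.card ≤ n := (Finset.card_le_univ _).trans_eq (Fintype.card_fin n)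
    have h2 := sum_exchMass_mul_prod q T
    rw [h _ hT] at h2
    exact mul_left_cancel₀ (by exact_mod_cast (Nat.choose_pos hT').ne') h2
  refine ⟨fun x => div_nonneg (hq _) (Nat.cast_nonneg _), by simpa using h1 ∅ (by simp), ?_⟩
  intro S _ hS
  rw [prAll_eq_sum]
  have h2 := sum_mul_prod_one_sub (exchMass n q) (fun x i => if x i = false then 1 else 0)
    (1 - p) S fun U hU => h1 U ((Finset.card_le_card hU).trans hS)
  rw [sub_sub_cancel] at h2
  rw [← h2]
  refine Finset.sum_congr rfl fun x _ => ?_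
  congr 1
  refine Finset.prod_congr rfl fun i _ => ?_
  cases x i <;> simp

lemma prAll_univ_exchMass {n : ℕ} (q : ℕ → ℝ) : prAll (exchMass n q) Finset.univ = q 0 := by
  rw [prAll]
  have : Finset.univ.filter (fun x : Fin n → Bool => ∀ i ∈ Finset.univ, x i = true) =
      {fun _ => true} := by
    ext x
    simp [funext_iff]
  have hz : (zeros (fun _ : Fin n => true)).card = 0 := card_zeros_eq_zero.2 fun _ => rfl
  rw [this, Finset.sum_singleton, exchMass, hz]
  simp

lemma gcubic_eq_binE (K d : ℕ) (p : ℝ) :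
    gcubic (K + 2 + d) (K + 2) p = binE (d + 3) (1 - p) (nodeFun 1) := by
  rw [binE_nodeFun_eq_sum, gcubic, Nat.add_sub_cancel_left]
  simp only [Finset.sum_range_succ, Finset.sum_range_zero]
  norm_num
  ring

lemma binE_fundFun_zero {K : ℕ} (hK : Even K) {d : ℕ} (hd : 2 ≤ d) (x : ℝ) :
    binE (K + 2 + d) x (fundFun K 0) = bonf (K + 2 + d) ((K + 2 : ℕ) : ℤ) x +
      (((K + 2 + d).choose (K + 2 + 1) : ℝ) / ((K + 2 + d - (K + 2) + 1).choose 2 : ℝ)) *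
        x ^ (K + 2 - 1) * bonf (K + 2 + d - (K + 2) + 1) 1 x := by
  rw [binE_fundFun_of_le (Nat.zero_le K) (Nat.zero_le _)]
  simp only [Nat.sub_zero]
  rw [binE_nodeFun_eq_sum, Nat.add_sub_cancel_left, hK.neg_one_pow, bonf,
    if_neg (by omega), Int.toNat_natCast, bonf, if_neg (by norm_num)]
  have h1 := cast_choose_succ_mul (K + 1) (d + 1)
  have h2 := cast_choose_succ_mul (K + 2) d
  rw [show K + 1 + (d + 1) = K + 2 + d by ring, show K + 1 + 1 = K + 2 by ring] at h1
  push_cast at h1 h2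
  have hd' : (2 : ℝ) ≤ d := by exact_mod_cast hd
  have h3 : ((K + 2 + d).choose (K + 2 + 1) : ℝ) / ((d + 1).choose 2 : ℝ) =
      2 / ((K + 2) * (K + 3)) * (K + 2 + d).choose (K + 1) := by
    rw [Nat.cast_choose_two]
    push_cast
    have : (d : ℝ) + 1 - 1 = d := by ring
    rw [this]
    have hK0 : (0 : ℝ) ≤ K := K.cast_nonneg
    field_simp
    linear_combination ((K : ℝ) + 2) * h2 + (d : ℝ) * h1
  rw [h3]
  simp only [Nat.choose_zero_right, Nat.cast_one, pow_zero, one_mul,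
    show K + 2 - 1 = K + 1 from rfl, show (1 : ℤ).toNat + 1 = 2 from rfl, Finset.sum_range_succ,
    Finset.sum_range_zero, Nat.choose_one_right]
  push_cast
  simp only [← mul_assoc]
  linear_combination (-2 / (((K : ℝ) + 2) * (K + 3)) * x ^ (K + 2)) * h1

lemma fundFun_zero_nonneg {K : ℕ} (hK : Even K) {u : ℕ} (hu : 1 ≤ u) :
    0 ≤ fundFun K 0 u ∧ (fundFun K 0 u = 0 → u ∈ nodes K) := by
  have e : fundFun K 0 u = nodeFun K u := by simp [fundFun]
  rw [e]
  rcases le_or_gt u K with h | h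
  · exact ⟨(nodeFun_eq_zero hu h).ge, fun _ => mem_nodes.2 (Or.inl h)⟩
  · obtain ⟨w, rfl⟩ := Nat.exists_eq_add_of_le (Nat.succ_le_of_lt h)
    rw [nodeFun_add, hK.neg_one_pow, one_mul]
    refine ⟨div_nonneg (mul_nonneg (by positivity) (sub_one_mul_sub_two_nonneg w))
      (by positivity), fun h0 => ?_⟩
    have hc : ((K + w).choose K : ℝ) ≠ 0 := by
      exact_mod_cast (Nat.choose_pos (by omega)).ne'
    have hd : ((K : ℝ) + 2) * (K + 3) ≠ 0 := by positivity
    rcases div_eq_zero_iff.1 h0 with h1 | h1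
    · rcases mul_eq_zero.1 ((mul_eq_zero.1 h1).resolve_left hc) with h2 | h2
      · have : w = 1 := by exact_mod_cast sub_eq_zero.1 h2
        exact mem_nodes.2 (by omega)
      · have : w = 2 := by exact_mod_cast sub_eq_zero.1 h2
        exact mem_nodes.2 (by omega)
    · exact absurd h1 hd

lemma exists_pos_forall_add_mul_nonneg {ι : Type*} (s : Finset ι) (A B : ι → ℝ)
    (hA : ∀ u ∈ s, 0 ≤ A u) (hB : ∀ u ∈ s, A u = 0 → 0 ≤ B u) :
    ∃ ε > 0, ∀ u ∈ s, 0 ≤ A u + ε * B u := by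
  have h (u : ι) (hu : u ∈ s) : ∀ᶠ ε in nhdsWithin (0 : ℝ) (Set.Ioi 0), 0 ≤ A u + ε * B u := by
    rcases (hA u hu).eq_or_lt with h0 | h0
    · filter_upwards [self_mem_nhdsWithin] with ε hε
      rw [← h0, zero_add]
      exact mul_nonneg (le_of_lt hε) (hB u hu h0.symm)
    · have hc : ContinuousAt (fun ε : ℝ => A u + ε * B u) 0 := by fun_prop
      have := hc.eventually (lt_mem_nhds (a := 0) (by simpa using h0))
      exact (this.filter_mono nhdsWithin_le_nhds).mono fun _ h => h.le
  obtain ⟨ε, h1, h2⟩ := ((Filter.eventually_all_finset s).2 h |>.and self_mem_nhdsWithin).exists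
  exact ⟨ε, h2, h1⟩

lemma M_eq_binE {K d : ℕ} (hK : Even K) (hd : 2 ≤ d) {p : ℝ} (h0 : p ≤ 1)
    (h1 : 1 ≤ (d + 1) * (1 - p)) (h2 : 1 - p ≤ 4 / (2 * (d + 1 : ℕ) + 3))
    (h : 0 ≤ gcubic (K + 2 + d) (K + 2) p) :
    M (K + 2 + d) (K + 2) p = binE (K + 2 + d) (1 - p) (fundFun K 0) := by
  rw [gcubic_eq_binE] at h
  refine IsGreatest.csSup_eq ⟨⟨exchMass (K + 2 + d) fun j => binE (K + 2 + d) (1 - p) (fundFun K j),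
    memA_exchMass (binE_fundFun_nonneg hd (by linarith) h1 h2 h) fun s hs =>
      sum_binE_fundFun_mul_choose (by omega) hs _, prAll_univ_exchMass _⟩, ?_⟩
  rintro y ⟨f, hf, rfl⟩
  refine prAll_univ_le_binE hf (fundFun_mem_chooseSpan K 0) ?_
    fun u hu _ => (fundFun_zero_nonneg hK hu).1
  rw [fundFun_of_le (Nat.zero_le K) (mem_nodes.2 (Or.inl (Nat.zero_le K))), if_pos rfl]

lemma M_lt_binE {K d : ℕ} (hK : Even K) (hK2 : 2 ≤ K) {p : ℝ} (h0 : 0 < p)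
    (h1 : p < 1) (h : gcubic (K + 2 + d) (K + 2) p < 0) :
    M (K + 2 + d) (K + 2) p < binE (K + 2 + d) (1 - p) (fundFun K 0) := by
  rw [gcubic_eq_binE] at h
  have hx : 0 < 1 - p := by linarith
  obtain ⟨ε, hε, hu⟩ := exists_pos_forall_add_mul_nonneg (Finset.Icc 1 (K + 2 + d))
    (fundFun K 0) (fundFun K (K - 1))
    (fun u hu => (fundFun_zero_nonneg hK (Finset.mem_Icc.1 hu).1).1) fun u hu hz => by
      have := (fundFun_zero_nonneg hK (Finset.mem_Icc.1 hu).1).2 hz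
      rw [fundFun_of_le (Nat.sub_le K 1) this]
      split_ifs <;> norm_num
  have hneg : binE (K + 2 + d) (1 - p) (fundFun K (K - 1)) < 0 := by
    rw [binE_fundFun_of_le (Nat.sub_le K 1) (by omega),
      show K + 2 + d - (K - 1) = d + 3 by omega, show K - (K - 1) = 1 by omega]
    have : 0 < ((K + 2 + d).choose (K - 1) : ℝ) := by
      exact_mod_cast Nat.choose_pos (by omega)
    exact mul_neg_of_pos_of_neg (by positivity) h
  have hpos : 0 < binE (K + 2 + d) (1 - p) (fundFun K 0) := by
    rw [binE_fundFun_of_le (Nat.zero_le K) (Nat.zero_le _),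
      show K + 2 + d - 0 = d + 1 + K + 1 by omega, Nat.sub_zero]
    simpa using binE_nodeFun_pos_of_even hK (d + 1) hx.le (by linarith)
  rcases Set.eq_empty_or_nonempty
    {y : ℝ | ∃ f, memA (K + 2 + d) (K + 2) p f ∧ prAll f Finset.univ = y} with he | hne
  · rwa [M, he, Real.sSup_empty]
  · refine (csSup_le hne (a := binE (K + 2 + d) (1 - p)
      (fundFun K 0 + ε • fundFun K (K - 1))) ?_).trans_lt ?_
    · rintro y ⟨f, hf, rfl⟩
      refine prAll_univ_le_binE hf (Submodule.add_mem _ (fundFun_mem_chooseSpan K 0)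
        (Submodule.smul_mem _ _ (fundFun_mem_chooseSpan K (K - 1)))) ?_
        fun u hu1 hu2 => hu u (Finset.mem_Icc.2 ⟨hu1, hu2⟩)
      have h0 : 0 ∈ nodes K := mem_nodes.2 (Or.inl (Nat.zero_le K))
      simp only [Pi.add_apply, Pi.smul_apply, smul_eq_mul]
      rw [fundFun_of_le (Nat.zero_le K) h0, fundFun_of_le (Nat.sub_le K 1) h0, if_pos rfl,
        if_neg (by omega)]
      simp
    · rw [binE_add, binE_smul]
      have := mul_neg_of_pos_of_neg hε hneg
      linarith

lemma gcubic_eq (K d : ℕ) (p : ℝ) : gcubic (K + 2 + d) (K + 2) p =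
    1 - (d + 3) * (1 - p) + 5 / 12 * ((d + 3) * (d + 2)) * (1 - p) ^ 2 -
      1 / 12 * ((d + 3) * (d + 2) * (d + 1)) * (1 - p) ^ 3 := by
  have h2 : ((d + 3).choose 2 : ℝ) = (d + 3) * (d + 2) / 2 := by
    rw [Nat.cast_choose_two]
    push_cast
    ring
  have h3 : ((d + 3).choose 3 : ℝ) = (d + 3) * (d + 2) * (d + 1) / 6 := by
    have := cast_choose_succ_mul 2 (d + 1)
    rw [show 2 + (d + 1) = d + 3 by ring, h2] at this
    norm_num at this
    linarith
  rw [gcubic, Nat.add_sub_cancel_left, h2, h3, Nat.choose_one_right]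
  push_cast
  ring

lemma gcubic_strictMono (K : ℕ) {d : ℕ} (hd : 2 ≤ d) :
    StrictMono (gcubic (K + 2 + d) (K + 2)) := by
  intro p p' hp
  rw [gcubic_eq, gcubic_eq, ← sub_pos]
  have hd' : (2 : ℝ) ≤ d := by exact_mod_cast hd
  set x := 1 - p
  set y := 1 - p'
  have hxy : 0 < x - y := by simp only [x, y]; linarith
  have key : 0 < 1 - 5 / 12 * (d + 2) * (x + y) +
      1 / 12 * ((d + 2) * (d + 1)) * (x ^ 2 + x * y + y ^ 2) := by
    have h1 : 3 / 4 * (x + y) ^ 2 ≤ x ^ 2 + x * y + y ^ 2 := by nlinarith [sq_nonneg (x - y)]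
    have h2 : 0 ≤ 1 / 12 * (((d : ℝ) + 2) * (d + 1)) := by positivity
    have h3 := mul_le_mul_of_nonneg_left h1 h2
    have h4 : 0 < 1 - 5 / 12 * (d + 2) * (x + y) + ((d : ℝ) + 2) * (d + 1) / 16 * (x + y) ^ 2 := by
      have e : 1 - 5 / 12 * (d + 2) * (x + y) + ((d : ℝ) + 2) * (d + 1) / 16 * (x + y) ^ 2 =
          (1 - 5 / 24 * (d + 2) * (x + y)) ^ 2 +
            ((d : ℝ) + 2) * (11 * d - 14) / 576 * (x + y) ^ 2 := by ring
      rw [e]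
      rcases eq_or_ne (x + y) 0 with hs | hs
      · norm_num [hs]
      · have h5 : 0 < 11 * (d : ℝ) - 14 := by linarith
        have h6 : 0 < (x + y) ^ 2 := by positivity
        positivity
    linarith
  have := mul_pos (mul_pos (by positivity : (0 : ℝ) < d + 3) hxy) key
  linarith

lemma exists_gcubic_eq_zero (K : ℕ) {d : ℕ} (hd : 2 ≤ d) :
    ∃ z ∈ Set.Icc (1 - 4 / (2 * ((d : ℝ) + 1) + 3)) (1 - 1 / ((d : ℝ) + 1)),
      gcubic (K + 2 + d) (K + 2) z = 0 := by
  have hd' : (2 : ℝ) ≤ d := by exact_mod_cast hd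
  have hc : Continuous (gcubic (K + 2 + d) (K + 2)) := by
    unfold gcubic
    fun_prop
  have hle : 1 - 4 / (2 * ((d : ℝ) + 1) + 3) ≤ 1 - 1 / ((d : ℝ) + 1) := by
    apply sub_le_sub_left
    rw [div_le_div_iff₀ (by positivity) (by positivity)]
    linarith
  have hl : gcubic (K + 2 + d) (K + 2) (1 - 4 / (2 * ((d : ℝ) + 1) + 3)) ≤ 0 := by
    rw [gcubic_eq, sub_sub_cancel]
    have : 1 - (d + 3) * (4 / (2 * ((d : ℝ) + 1) + 3)) +
        5 / 12 * ((d + 3) * (d + 2)) * (4 / (2 * ((d : ℝ) + 1) + 3)) ^ 2 -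
        1 / 12 * ((d + 3) * (d + 2) * (d + 1)) * (4 / (2 * ((d : ℝ) + 1) + 3)) ^ 3 =
        -(2 * d + 7) / (2 * ((d : ℝ) + 1) + 3) ^ 3 := by
      field_simp
      ring
    rw [this]
    apply div_nonpos_of_nonpos_of_nonneg
    · linarith
    · positivity
  have hr : 0 ≤ gcubic (K + 2 + d) (K + 2) (1 - 1 / ((d : ℝ) + 1)) := by
    rw [gcubic_eq, sub_sub_cancel]
    have : 1 - (d + 3) * (1 / ((d : ℝ) + 1)) +
        5 / 12 * ((d + 3) * (d + 2)) * (1 / ((d : ℝ) + 1)) ^ 2 -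
        1 / 12 * ((d + 3) * (d + 2) * (d + 1)) * (1 / ((d : ℝ) + 1)) ^ 3 =
        d * (d - 1) / (3 * ((d : ℝ) + 1) ^ 2) := by
      field_simp
      ring
    rw [this]
    have : (0 : ℝ) ≤ d - 1 := by linarith
    positivity
  obtain ⟨z, hz, hz0⟩ := intermediate_value_Icc hle hc.continuousOn ⟨hl, hr⟩
  exact ⟨z, hz, hz0⟩

/-- identification of the left endpoint `ρ̄` of the second-to-last interval,
for even `k ≥ 4`. -/
theorem stmt14 (n k : ℕ) (hk : 4 ≤ k) (hkn : k + 2 ≤ n) (hke : Even k) (ρ : ℝ)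
    (hρ : ρ = sInf {p₂ : ℝ | p₂ ≤ 1 - 1 / ((n:ℝ) - (k:ℝ) + 1) ∧
      ∀ p ∈ Set.Icc p₂ (1 - 1 / ((n:ℝ) - (k:ℝ) + 1)),
        M n k p = bonf n (k : ℤ) (1 - p) +
          ((n.choose (k + 1) : ℝ) / ((n - k + 1).choose 2 : ℝ)) * (1 - p) ^ (k - 1) *
            bonf (n - k + 1) 1 (1 - p)}) :
    ∃ z : ℝ,
      z ∈ Set.Icc (1 - 2 / ((n:ℝ) - (k:ℝ) + 1)) (1 - 1 / ((n:ℝ) - (k:ℝ) + 1)) ∧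
      gcubic n k z = 0 ∧
      (∀ y ∈ Set.Icc (1 - 2 / ((n:ℝ) - (k:ℝ) + 1)) (1 - 1 / ((n:ℝ) - (k:ℝ) + 1)),
        gcubic n k y = 0 → y = z) ∧
      ρ = z := by
  obtain ⟨K, rfl⟩ : ∃ K, k = K + 2 := ⟨k - 2, by omega⟩
  obtain ⟨d, rfl⟩ := Nat.exists_eq_add_of_le (show K + 2 ≤ n by omega)
  have hK : Even K := by
    rwa [Nat.even_add, iff_true_right even_two] at hke
  have hd : 2 ≤ d := by omega
  have hd' : (2 : ℝ) ≤ d := by exact_mod_cast hd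
  have hm : ((K + 2 + d : ℕ) : ℝ) - ((K + 2 : ℕ) : ℝ) + 1 = d + 1 := by
    push_cast
    ring
  rw [hm] at hρ ⊢
  obtain ⟨z, hz, hz0⟩ := exists_gcubic_eq_zero K hd
  have hmono := gcubic_strictMono K hd
  have hleft : 1 - 2 / ((d : ℝ) + 1) < 1 - 4 / (2 * ((d : ℝ) + 1) + 3) := by
    apply sub_lt_sub_left
    rw [div_lt_div_iff₀ (by positivity) (by positivity)]
    linarith
  refine ⟨z, ⟨hleft.le.trans hz.1, hz.2⟩, hz0,
    fun y _ hy => hmono.injective (hy.trans hz0.symm), ?_⟩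
  rw [hρ]
  refine IsLeast.csInf_eq ⟨⟨hz.2, fun p hp => ?_⟩, ?_⟩
  · have h1 : 1 / ((d : ℝ) + 1) ≤ 1 - p := by linarith [hp.2]
    have h1' : 0 < 1 / ((d : ℝ) + 1) := by positivity
    rw [← binE_fundFun_zero hK hd]
    refine M_eq_binE hK hd (by linarith) ?_ ?_ ?_
    · rw [div_le_iff₀ (by positivity)] at h1
      linarith
    · push_cast
      linarith [hz.1, hp.1]
    · rw [← hz0]
      exact hmono.monotone hp.1
  · rintro p₂ ⟨hp₂, hM⟩
    by_contra! hlt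
    have hpz : max p₂ (1 - 2 / ((d : ℝ) + 1)) < z := max_lt hlt (hleft.trans_le hz.1)
    have h := hM (max p₂ (1 - 2 / ((d : ℝ) + 1))) ⟨le_max_left _ _, hpz.le.trans hz.2⟩
    rw [← binE_fundFun_zero hK hd] at h
    refine (M_lt_binE hK (by omega) ?_ ?_ (hz0 ▸ hmono hpz)).ne h
    · refine lt_of_lt_of_le ?_ (le_max_right _ _)
      rw [sub_pos, div_lt_one (by positivity)]
      linarith
    · have : 0 < 1 / ((d : ℝ) + 1) := by positivity
      linarith [hz.2]
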